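/- arXiv:1908.01200 — 2 statements merged into one kernel-verified Lean document; each statement's English description precedes it below -/
import Mathlib

section
/- Let M be an m-valued matrix and r a rule with premises A₁,…,Aₙ and conclusion C₀. If there is a substitution σ such that A₁σ,…,Aₙσ are all tautologies of M but C₀σ is not, then there is such a substitution σ' for which the formulas substituted for the variables of the rule together contain at most m distinct propositional variables, and each substituted formula X σ' has depth at most m^(m^m). -/
/-- A propositional signature: a set of connectives with arities. -/
structure Signature where
  Conn : Type
  arity : Conn → ℕ

/-- Propositional formulas over a signature, with variables `X₀, X₁, …`. -/
inductive Fm (S : Signature) : Type where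
  | var : ℕ → Fm S
  | app : (c : S.Conn) → (Fin (S.arity c) → Fm S) → Fm S

namespace Fm

variable {S : Signature}

/-- Applying a substitution (a map from variables to formulas) to a formula. -/
def subst (σ : ℕ → Fm S) : Fm S → Fm S
  | var n => σ n
  | app c args => app c (fun i => subst σ (args i))

/-- The depth of a formula: variables and constants have depth 0. -/
def depth : Fm S → ℕ
  | var _ => 0
  | app c args =>
      if S.arity c = 0 then 0 else (Finset.univ.sup fun i => depth (args i)) + 1

/-- The (finite) set of variables occurring in a formula. -/
def fvars : Fm S → Finset ℕ
  | var n => {n}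
  | app _ args => Finset.univ.biUnion fun i => fvars (args i)

end Fm

/-- A (possibly infinite-valued) matrix for a signature: truth values,
designated values, and truth functions for the connectives. -/
structure MvMatrix (S : Signature) where
  V : Type
  desig : Set V
  interp : (c : S.Conn) → (Fin (S.arity c) → V) → V

namespace MvMatrix

variable {S : Signature}

/-- Homomorphic extension of a valuation to all formulas. -/
def eval (M : MvMatrix S) (v : ℕ → M.V) : Fm S → M.V
  | .var n => v n
  | .app c args => M.interp c fun i => M.eval v (args i)

/-- A valuation satisfies a formula if it evaluates to a designated value. -/
def Sat (M : MvMatrix S) (v : ℕ → M.V) (A : Fm S) : Prop := M.eval v A ∈ M.desig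

/-- A formula is a tautology of a matrix if every valuation satisfies it. -/
def Taut (M : MvMatrix S) (A : Fm S) : Prop := ∀ v, M.Sat v A

/-- The product of two matrices: componentwise truth functions, a pair is
designated iff both components are. -/
def prod (M M' : MvMatrix S) : MvMatrix S where
  V := M.V × M'.V
  desig := {p | p.1 ∈ M.desig ∧ p.2 ∈ M'.desig}
  interp c args := (M.interp c fun i => (args i).1, M'.interp c fun i => (args i).2)

end MvMatrix

/-- A rule of a Hilbert-type calculus: finitely many premises and a conclusion. -/
structure Rule (S : Signature) where
  prems : List (Fm S)
  concl : Fm S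

/-- A propositional Hilbert-type calculus: finitely many axioms and rules. -/
structure Calc (S : Signature) where
  axioms : List (Fm S)
  rules : List (Rule S)

/-- Derivability in a Hilbert-type calculus: substitution instances of axioms,
closed under substitution instances of the rules. -/
inductive Deriv {S : Signature} (C : Calc S) : Fm S → Prop where
  | ax : ∀ A ∈ C.axioms, ∀ σ, Deriv C (A.subst σ)
  | rule : ∀ r ∈ C.rules, ∀ σ, (∀ A ∈ r.prems, Deriv C (A.subst σ)) →
      Deriv C (r.concl.subst σ)

/-- `C` is strongly sound for `M`: all axioms are tautologies, and any valuation
satisfying the premises of a rule satisfies its conclusion. -/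
def StronglySound {S : Signature} (C : Calc S) (M : MvMatrix S) : Prop :=
  (∀ A ∈ C.axioms, M.Taut A) ∧
  ∀ r ∈ C.rules, ∀ v, (∀ A ∈ r.prems, M.Sat v A) → M.Sat v r.concl

/-- `C` is t-sound for `M`: all axioms are tautologies, and for every rule and
substitution, if all instances of the premises are tautologies, so is the
instance of the conclusion. -/
def TSound {S : Signature} (C : Calc S) (M : MvMatrix S) : Prop :=
  (∀ A ∈ C.axioms, M.Taut A) ∧
  ∀ r ∈ C.rules, ∀ σ, (∀ A ∈ r.prems, M.Taut (A.subst σ)) → M.Taut (r.concl.subst σ)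

/-- `C` is weakly sound for `M`: every theorem of `C` is a tautology of `M`. -/
def WeaklySound {S : Signature} (C : Calc S) (M : MvMatrix S) : Prop :=
  ∀ F, Deriv C F → M.Taut F

/-- The variables occurring in a rule (in its conclusion or any premise). -/
def Rule.vars {S : Signature} (r : Rule S) : Finset ℕ :=
  (r.concl :: r.prems).foldr (fun A s => A.fvars ∪ s) ∅

namespace Fm

variable {S : Signature}

theorem subst_subst (σ τ : ℕ → Fm S) (A : Fm S) :
    (A.subst σ).subst τ = A.subst fun n => (σ n).subst τ := by
  induction A with
  | var n => rfl
  | app c args ih => simp only [subst, ih]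

theorem fvars_subst_var_subset (f : ℕ → ℕ) {s : Finset ℕ} (hf : ∀ n, f n ∈ s) (A : Fm S) :
    (A.subst fun n => var (f n)).fvars ⊆ s := by
  induction A with
  | var n => simpa [subst, fvars] using hf n
  | app c args ih => simpa [subst, fvars] using ih

end Fm

namespace MvMatrix

variable {S : Signature} (M : MvMatrix S)

theorem eval_subst (σ : ℕ → Fm S) (v : ℕ → M.V) (A : Fm S) :
    M.eval v (A.subst σ) = M.eval (fun n => M.eval v (σ n)) A := by
  induction A with
  | var n => rfl
  | app c args ih => simp only [Fm.subst, eval, ih]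

theorem eval_congr {v w : ℕ → M.V} {A : Fm S} (h : ∀ n ∈ A.fvars, v n = w n) :
    M.eval v A = M.eval w A := by
  induction A with
  | var n => exact h n (by simp [Fm.fvars])
  | app c args ih =>
    simp only [eval]
    congr 1
    funext i
    exact ih i fun n hn => h n (Finset.mem_biUnion.2 ⟨i, Finset.mem_univ i, hn⟩)

theorem Taut.subst {M : MvMatrix S} {A : Fm S} (h : M.Taut A) (σ : ℕ → Fm S) :
    M.Taut (A.subst σ) := fun v => by
  rw [Sat, eval_subst]
  exact h _

/-- Two formulas are equivalent if they agree under every valuation. -/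
def Equivalent (A B : Fm S) : Prop := ∀ v, M.eval v A = M.eval v B

/-- A formula with variables in `s` of least depth among the equivalent formulas with
variables in `s`. -/
def IsShallowest (s : Finset ℕ) (A : Fm S) : Prop :=
  A.fvars ⊆ s ∧ ∀ B : Fm S, B.fvars ⊆ s → M.Equivalent B A → A.depth ≤ B.depth

variable {M}

theorem exists_isShallowest {s : Finset ℕ} {A : Fm S} (hA : A.fvars ⊆ s) :
    ∃ B, M.IsShallowest s B ∧ M.Equivalent B A := by
  obtain ⟨B, ⟨hBs, hBA⟩, hmin⟩ := exists_minimalFor_of_wellFoundedLT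
    (fun B : Fm S => B.fvars ⊆ s ∧ M.Equivalent B A) Fm.depth ⟨A, hA, fun _ => rfl⟩
  refine ⟨B, ⟨hBs, fun C hCs hCB => ?_⟩, hBA⟩
  rcases le_total B.depth C.depth with h | h
  · exact h
  · exact hmin ⟨hCs, fun v => (hCB v).trans (hBA v)⟩ h

theorem IsShallowest.exists_depth_eq {s : Finset ℕ} {d : ℕ} {A : Fm S}
    (hA : M.IsShallowest s A) (hd : A.depth = d + 1) :
    ∃ B, M.IsShallowest s B ∧ B.depth = d := by
  cases A with
  | var n => simp [Fm.depth] at hd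
  | app c args =>
    have hc : S.arity c ≠ 0 := fun h => by simp [Fm.depth, h] at hd
    have : NeZero (S.arity c) := ⟨hc⟩
    obtain ⟨hAs, hmin⟩ := hA
    have hargs (i) : (args i).fvars ⊆ s :=
      (Finset.subset_biUnion_of_mem (fun i => (args i).fvars) (Finset.mem_univ i)).trans hAs
    choose B hB hBe using fun i => exists_isShallowest (M := M) (hargs i)
    have hle := hmin (.app c B) (Finset.biUnion_subset.2 fun i _ => (hB i).1)
      fun v => by simp only [eval, hBe _ v]
    obtain ⟨i, -, hi⟩ := Finset.exists_mem_eq_sup Finset.univ Finset.univ_nonempty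
      fun i => (B i).depth
    have hBi := (hB i).2 (args i) (hargs i) fun v => (hBe i v).symm
    have hsup := Finset.le_sup (f := fun i => (args i).depth) (Finset.mem_univ i)
    simp only [Fm.depth, hc, if_false] at hd hle
    refine ⟨B i, hB i, ?_⟩
    omega

theorem IsShallowest.exists_depth_eq_of_le {s : Finset ℕ} {A : Fm S}
    (hA : M.IsShallowest s A) {k : ℕ} (hk : k ≤ A.depth) :
    ∃ B, M.IsShallowest s B ∧ B.depth = k := by
  induction hk using Nat.decreasingInduction with
  | self => exact ⟨A, hA, rfl⟩
  | of_succ k _ ih =>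
    obtain ⟨B, hB, hBk⟩ := ih
    exact hB.exists_depth_eq hBk

theorem IsShallowest.depth_lt [Finite M.V] [Nonempty M.V] {s : Finset ℕ} {A : Fm S}
    (hA : M.IsShallowest s A) : A.depth < Nat.card M.V ^ Nat.card M.V ^ s.card := by
  classical
  choose B hB hBd using fun k : Fin (A.depth + 1) =>
    hA.exists_depth_eq_of_le (Nat.le_of_lt_succ k.2)
  let table (k : Fin (A.depth + 1)) (u : s → M.V) : M.V :=
    M.eval (fun n => if h : n ∈ s then u ⟨n, h⟩ else Classical.arbitrary M.V) (B k)
  have equiv {k l} (h : table k = table l) : M.Equivalent (B k) (B l) := fun v => by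
    have restrict (j) : M.eval v (B j) = table j fun n => v n :=
      M.eval_congr fun n hn => by simp [(hB j).1 hn]
    rw [restrict, restrict, h]
  have inj : Function.Injective table := fun k l h => Fin.ext <| by
    rw [← hBd k, ← hBd l]
    exact le_antisymm ((hB k).2 _ (hB l).1 (equiv h.symm)) ((hB l).2 _ (hB k).1 (equiv h))
  have := Nat.card_le_card_of_injective table inj
  rwa [Nat.card_fun, Nat.card_fun, Nat.card_fin, Nat.card_eq_fintype_card (α := s),
    Fintype.card_coe, Nat.succ_le_iff] at this

theorem Taut.subst_congr {σ τ : ℕ → Fm S} (h : ∀ n, M.Equivalent (σ n) (τ n)) (A : Fm S) :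
    M.Taut (A.subst σ) ↔ M.Taut (A.subst τ) := by
  simp only [Taut, Sat, eval_subst, fun v n => h n v]

end MvMatrix

/-- Let `M` be `m`-valued and `r` a rule with premises
`A₁,…,Aₙ` and conclusion `C₀`. If some substitution `σ` makes all `Aᵢσ`
tautologies of `M` but `C₀σ` not a tautology, then there is such a
substitution `σ'` for which the formulas substituted for the variables of
the rule together contain at most `m` distinct variables, and each
substituted formula has depth at most `m^(m^m)`. -/
theorem small_tsound_counterexample {S : Signature} (M : MvMatrix S)
    (m : ℕ) (hfin : Finite M.V) (hm : Nat.card M.V = m) (r : Rule S)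
    (hex : ∃ σ : ℕ → Fm S,
      (∀ A ∈ r.prems, M.Taut (A.subst σ)) ∧ ¬ M.Taut (r.concl.subst σ)) :
    ∃ σ' : ℕ → Fm S,
      (∀ A ∈ r.prems, M.Taut (A.subst σ')) ∧ ¬ M.Taut (r.concl.subst σ') ∧
      (r.vars.biUnion fun X => (σ' X).fvars).card ≤ m ∧
      ∀ X ∈ r.vars, (σ' X).depth ≤ m ^ m ^ m := by
  obtain ⟨σ, hprems, hconcl⟩ := hex
  obtain ⟨v, hv⟩ := not_forall.1 hconcl
  have : Nonempty M.V := ⟨v 0⟩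
  let e : M.V ≃ Fin m := Finite.equivFinOfCardEq hm
  let code (n : ℕ) : ℕ := e (v n)
  have hcode (n) : code n ∈ Finset.range m := Finset.mem_range.2 (e (v n)).2
  let ρ (n : ℕ) : Fm S := (σ n).subst fun k => .var (code k)
  choose σ' hσ' hequiv using fun n => MvMatrix.exists_isShallowest (M := M) (A := ρ n)
    (Fm.fvars_subst_var_subset code hcode (σ n))
  refine ⟨σ', fun A hA => ?_, fun h => ?_, ?_, fun X _ => ?_⟩
  · rw [MvMatrix.Taut.subst_congr hequiv, ← Fm.subst_subst]
    exact (hprems A hA).subst _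
  · rw [MvMatrix.Taut.subst_congr hequiv, ← Fm.subst_subst] at h
    have hw := h fun k => if hk : k < m then e.symm ⟨k, hk⟩ else v 0
    simp only [MvMatrix.Sat, M.eval_subst (fun k => .var (code k)), MvMatrix.eval] at hw
    exact hv (by simpa [code, MvMatrix.Sat] using hw)
  · simpa using Finset.card_le_card (Finset.biUnion_subset.2 fun X (_ : X ∈ r.vars) => (hσ' X).1)
  · simpa [hm] using (hσ' X).depth_lt.le
end

section
/- Let K₁, K₂, … be a sequence of finite Kripke models and let Taut(L) be the set of modal formulas true in every Kripke model ⟨Wᵢ, Rᵢ, P'⟩ obtained from the frame of some Kᵢ by an arbitrary assignment P'. Define M₁ = M_{K₁} and M_{i+1} = Mᵢ × M_{K_{i+1}}. Then Taut(M_{i+1}) ⊆ Taut(Mᵢ) for all i, and ⋂_{i ≥ 1} Taut(Mᵢ) = Taut(L). -/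
/-- The modal propositional language with `¬, ∧, ∨, →, □, ◇`. -/
inductive ModConn : Type where
  | neg | conj | disj | imp | box | dia

abbrev ModSig : Signature where
  Conn := ModConn
  arity := fun c => match c with | .neg => 1 | .box => 1 | .dia => 1 | _ => 2

/-- A Kripke model: worlds, accessibility relation, and an assignment of
sets of worlds to propositional variables. -/
structure Kripke where
  W : Type
  R : W → W → Prop
  P : ℕ → Set W

/-- Truth of a modal formula at a world of a Kripke model. -/
def Kripke.forces (K : Kripke) (α : K.W) : Fm ModSig → Prop
  | .var n => α ∈ K.P n
  | .app c args =>
    match c with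
    | .neg => ¬ K.forces α (args 0)
    | .conj => K.forces α (args 0) ∧ K.forces α (args 1)
    | .disj => K.forces α (args 0) ∨ K.forces α (args 1)
    | .imp => K.forces α (args 0) → K.forces α (args 1)
    | .box => ∀ β, K.R α β → K.forces β (args 0)
    | .dia => ∃ β, K.R α β ∧ K.forces β (args 0)

open Classical

/-- The matrix `M_K` associated with a (finite) Kripke model `K`: truth values
are the functions `W → {0,1}`, the sole designated value is the constant-1
function, the classical connectives act componentwise, and `□, ◇` are
interpreted via the accessibility relation. -/
noncomputable def MK (K : Kripke) : MvMatrix ModSig where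
  V := K.W → Bool
  desig := {w | ∀ α, w α = true}
  interp c args :=
    match c with
    | .neg => fun α => !(args 0 α)
    | .conj => fun α => args 0 α && args 1 α
    | .disj => fun α => args 0 α || args 1 α
    | .imp => fun α => !(args 0 α) || args 1 α
    | .box => fun β => decide (∀ γ, K.R β γ → args 0 γ = true)
    | .dia => fun β => decide (∃ γ, K.R β γ ∧ args 0 γ = true)

/-- The valuation `v_K` of `M_K` induced by the assignment of the Kripke
model `K`: `(v_K(X))_α = 1` iff `α ∈ P(X)`. -/
noncomputable def vK (K : Kripke) : ℕ → (K.W → Bool) :=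
  fun n α => decide (α ∈ K.P n)

/-- The approximating sequence: `M₁ = M_{K₁}` and `M_{i+1} = Mᵢ × M_{K_{i+1}}`. -/
noncomputable def Mseq (K : ℕ → Kripke) : ℕ → MvMatrix ModSig
  | 0 => MK (K 0)
  | i + 1 => (Mseq K i).prod (MK (K (i + 1)))

/-- A formula holds at a world of the value computed in `M_K` iff it is forced there under the
assignment read off from the valuation. -/
theorem MK_eval_eq_true_iff (K : Kripke) (v : ℕ → K.W → Bool) (A : Fm ModSig) (α : K.W) :
    (MK K).eval v A α = true ↔ Kripke.forces ⟨K.W, K.R, fun n => {β | v n β = true}⟩ α A := by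
  induction A generalizing α with
  | var n => exact Iff.rfl
  | app c args ih =>
    cases c <;> simp only [MvMatrix.eval, MK, Kripke.forces, ← ih] <;> simp [imp_iff_not_or]

/-- The tautologies of `M_K` are the formulas valid on the frame of `K`. -/
theorem MK_taut_iff (K : Kripke) (A : Fm ModSig) :
    (MK K).Taut A ↔ ∀ (P' : ℕ → Set K.W) (α : K.W), Kripke.forces ⟨K.W, K.R, P'⟩ α A := by
  refine ⟨fun h P' α => ?_, fun h v α => (MK_eval_eq_true_iff K v A α).2 (h _ α)⟩
  have hP : (fun n => {β | decide (β ∈ P' n) = true}) = P' := by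
    ext n β
    simp
  have hα := (MK_eval_eq_true_iff K (fun n β => decide (β ∈ P' n)) A α).1 (h _ α)
  rwa [hP] at hα

namespace MvMatrix

variable {S : Signature}

theorem eval_prod (M M' : MvMatrix S) (v : ℕ → (M.prod M').V) (A : Fm S) :
    (M.prod M').eval v A = (M.eval (fun n => (v n).1) A, M'.eval (fun n => (v n).2) A) := by
  induction A with
  | var n => rfl
  | app c args ih => simp only [eval, ih]; rfl

theorem sat_prod_iff (M M' : MvMatrix S) (v : ℕ → (M.prod M').V) (A : Fm S) :
    (M.prod M').Sat v A ↔ M.Sat (fun n => (v n).1) A ∧ M'.Sat (fun n => (v n).2) A := by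
  unfold Sat
  rw [eval_prod]
  exact Iff.rfl

theorem taut_prod_iff (M M' : MvMatrix S) [Nonempty M.V] [Nonempty M'.V] (A : Fm S) :
    (M.prod M').Taut A ↔ M.Taut A ∧ M'.Taut A :=
  ⟨fun h => ⟨fun v => ((sat_prod_iff M M' (fun n => (v n, Classical.arbitrary _)) A).1 (h _)).1,
    fun v => ((sat_prod_iff M M' (fun n => (Classical.arbitrary _, v n)) A).1 (h _)).2⟩,
    fun h v => (sat_prod_iff M M' v A).2 ⟨h.1 _, h.2 _⟩⟩

end MvMatrix

instance MK_nonempty (K : Kripke) : Nonempty (MK K).V :=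
  ⟨fun _ : K.W => true⟩

instance Mseq_nonempty (K : ℕ → Kripke) (i : ℕ) : Nonempty (Mseq K i).V := by
  induction i with
  | zero => exact MK_nonempty (K 0)
  | succ i ih => exact ih.elim fun x => (MK_nonempty (K (i + 1))).elim fun y => ⟨(x, y)⟩

theorem Mseq_succ_taut_iff (K : ℕ → Kripke) (i : ℕ) (A : Fm ModSig) :
    (Mseq K (i + 1)).Taut A ↔ (Mseq K i).Taut A ∧ (MK (K (i + 1))).Taut A :=
  MvMatrix.taut_prod_iff _ _ A

theorem forall_Mseq_taut_iff (K : ℕ → Kripke) (A : Fm ModSig) :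
    (∀ i, (Mseq K i).Taut A) ↔ ∀ i, (MK (K i)).Taut A := by
  refine ⟨fun h i => ?_, fun h i => ?_⟩
  · cases i with
    | zero => exact h 0
    | succ i => exact ((Mseq_succ_taut_iff K i A).1 (h (i + 1))).2
  · induction i with
    | zero => exact h 0
    | succ i ih => exact (Mseq_succ_taut_iff K i A).2 ⟨ih, h (i + 1)⟩

/-- For a sequence `K₁, K₂, …` of finite Kripke models and the
sequence of matrices `M₁ = M_{K₁}`, `M_{i+1} = Mᵢ × M_{K_{i+1}}`:
`Taut(M_{i+1}) ⊆ Taut(Mᵢ)` for all `i`, and `⋂ᵢ Taut(Mᵢ)` equals the set of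
modal formulas true in every Kripke model obtained from the frame of some
`Kᵢ` by an arbitrary assignment. -/
theorem kripke_sequential_approximation (K : ℕ → Kripke)
    (hfin : ∀ i, Finite (K i).W) :
    (∀ i, {A | (Mseq K (i + 1)).Taut A} ⊆ {A | (Mseq K i).Taut A}) ∧
    (⋂ i, {A | (Mseq K i).Taut A}) =
      {A : Fm ModSig | ∀ i, ∀ P' : ℕ → Set (K i).W, ∀ α : (K i).W,
        Kripke.forces ⟨(K i).W, (K i).R, P'⟩ α A} := by
  refine ⟨fun i A hA => ((Mseq_succ_taut_iff K i A).1 hA).1, ?_⟩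
  ext A
  simp only [Set.mem_iInter, Set.mem_ofPred_eq, forall_Mseq_taut_iff, MK_taut_iff]
end
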